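/- Suppose that x·p has no terms of negative degree and that its constant term p₋₁ is an integer divisible by m. Then x^{−p₋₁}ℂ[x] (the span of the monomials x^n with n ≥ −p₋₁) is an invariant subspace of ℂ[x,x⁻¹]; in particular ℂ[x,x⁻¹] has an invariant subspace other than 0 and ℂ[x,x⁻¹], i.e. the module j₀M is reducible. -/

import Mathlib

noncomputable section

/-- The Laurent polynomial ring `ℂ[x,x⁻¹]`, viewed as the space of finitely supported
coefficient functions `ℤ →₀ ℂ`; the monomial `x^n` is `Finsupp.single n 1`. -/
abbrev LaurentC : Type := ℤ →₀ ℂ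

/-- The `ℂ`-linear endomorphism of `ℂ[x,x⁻¹]` determined by its values on the monomials
`x^n`, `n : ℤ`. -/
noncomputable def onMonomials (g : ℤ → LaurentC) : LaurentC →ₗ[ℂ] LaurentC :=
  Finsupp.lsum ℂ fun n => LinearMap.toSpanSingleton ℂ LaurentC (g n)

/-- Multiplication by `x`. -/
noncomputable def mulX : LaurentC →ₗ[ℂ] LaurentC :=
  onMonomials fun n => Finsupp.single (n + 1) 1

/-- The operator `s_i : x^n ↦ λ^{i n} x^n`. -/
noncomputable def sOp (lam : ℂ) (i : ℕ) : LaurentC →ₗ[ℂ] LaurentC :=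
  onMonomials fun n => Finsupp.single n (lam ^ ((i : ℤ) * n))

/-- The Dunkl operator
`D(x^n) = n x^{n-1} + p·x^n + Σ_{i=1}^{m-1} (2 c_i (1-λ^{in})/(1-λ^i)) x^{n-1}`. -/
noncomputable def dunkl (m : ℕ) (lam : ℂ) (c : ℕ → ℂ) (p : LaurentC) : LaurentC →ₗ[ℂ] LaurentC :=
  onMonomials fun n =>
    Finsupp.mapDomain (· + n) p +
      ((n : ℂ) + ∑ i ∈ Finset.Icc 1 (m - 1),
          2 * c i * (1 - lam ^ ((i : ℤ) * n)) / (1 - lam ^ (i : ℤ))) • Finsupp.single (n - 1) 1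

/-- A subspace `N ⊆ ℂ[x,x⁻¹]` is an invariant subspace if it is closed under multiplication
by `x`, under `s_1`, and under the Dunkl operator `D`; invariant subspaces are exactly the
submodules of the rational Cherednik algebra module `j₀M`. -/
def IsInvariantSubspace (m : ℕ) (lam : ℂ) (c : ℕ → ℂ) (p : LaurentC) (N : Submodule ℂ LaurentC) : Prop :=
  (∀ f ∈ N, mulX f ∈ N) ∧ (∀ f ∈ N, sOp lam 1 f ∈ N) ∧ (∀ f ∈ N, dunkl m lam c p f ∈ N)

/-- The subspace `x^k ℂ[x]`: the span of the monomials `x^n` with `n ≥ k`. -/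
noncomputable def tailSpace (k : ℤ) : Submodule ℂ LaurentC :=
  Submodule.span ℂ {f : LaurentC | ∃ n : ℤ, k ≤ n ∧ f = Finsupp.single n 1}

theorem onMonomials_single (g : ℤ → LaurentC) (n : ℤ) :
    onMonomials g (Finsupp.single n 1) = g n := by
  simp [onMonomials]

theorem mem_tailSpace (k : ℤ) (f : LaurentC) :
    f ∈ tailSpace k ↔ ∀ n : ℤ, n < k → f n = 0 := by
  constructor
  · intro hf n hn
    unfold tailSpace at hf
    induction hf using Submodule.span_induction with
    | mem x hx =>
      obtain ⟨j, hj, rfl⟩ := hx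
      exact Finsupp.single_eq_of_ne (by omega)
    | zero => rfl
    | add x y _ _ hx hy => simp [hx, hy]
    | smul a x _ hx => simp [hx]
  · intro h
    rw [← Finsupp.sum_single f]
    refine Submodule.sum_mem _ fun n hn => ?_
    have h1 : Finsupp.single n (f n) = f n • (Finsupp.single n 1 : LaurentC) := by simp
    rw [h1]
    refine Submodule.smul_mem _ _ (Submodule.subset_span ⟨n, ?_, rfl⟩)
    by_contra hk
    exact (Finsupp.mem_support_iff.mp hn) (h n (by omega))

theorem onMonomials_mem (g : ℤ → LaurentC) (k : ℤ)
    (h : ∀ n, k ≤ n → ∀ j, j < k → g n j = 0) :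
    ∀ f ∈ tailSpace k, onMonomials g f ∈ tailSpace k := by
  intro f hf
  have : tailSpace k ≤ (tailSpace k).comap (onMonomials g) := by
    conv_lhs => unfold tailSpace
    rw [Submodule.span_le]
    rintro _ ⟨n, hn, rfl⟩
    simp only [SetLike.mem_coe, Submodule.mem_comap, onMonomials_single]
    exact (mem_tailSpace _ _).2 (h n hn)
  exact this hf

/-- If `x·p` has no terms of negative degree and its constant term `p₋₁` is an integer
divisible by `m`, then `x^{−p₋₁}ℂ[x]` is an invariant subspace; in particular `j₀M` is
reducible. -/
theorem reducible_of_divisible_constant_term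
    (m : ℕ) (hm : 2 ≤ m) (lam : ℂ) (hlam : IsPrimitiveRoot lam m)
    (c : ℕ → ℂ) (p : LaurentC) (hp : ∀ n : ℤ, ¬ ((m : ℤ) ∣ (n + 1)) → p n = 0)
    (hpneg : ∀ n : ℤ, n < -1 → p n = 0)
    (l : ℤ) (hml : (m : ℤ) ∣ l) (hpl : p (-1) = (l : ℂ)) :
    IsInvariantSubspace m lam c p (tailSpace (-l)) ∧
      ∃ N : Submodule ℂ LaurentC, IsInvariantSubspace m lam c p N ∧ N ≠ ⊥ ∧ N ≠ ⊤ := by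
  have key : IsInvariantSubspace m lam c p (tailSpace (-l)) := by
    refine ⟨onMonomials_mem _ _ ?_, onMonomials_mem _ _ ?_, onMonomials_mem _ _ ?_⟩
    · intro n hn j hj
      exact Finsupp.single_eq_of_ne (by omega)
    · intro n hn j hj
      exact Finsupp.single_eq_of_ne (by omega)
    · intro n hn j hj
      have h1 : Finsupp.mapDomain (· + n) p j = p (j - n) := by
        have := Finsupp.mapDomain_apply (add_left_injective n) p (j - n)
        simpa using this
      rw [Finsupp.add_apply, Finsupp.smul_apply, h1]
      by_cases hj' : j = n - 1
      · have hnl : n = -l := by omega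
        have hjn : j - n = -1 := by omega
        rw [hjn, hpl, hj', Finsupp.single_eq_same]
        have hs : ∑ i ∈ Finset.Icc 1 (m - 1),
            2 * c i * (1 - lam ^ ((i : ℤ) * n)) / (1 - lam ^ (i : ℤ)) = 0 := by
          refine Finset.sum_eq_zero fun i _ => ?_
          have h2 : lam ^ ((i : ℤ) * n) = 1 := by
            rw [hlam.zpow_eq_one_iff_dvd, hnl]
            exact Dvd.dvd.mul_left ((dvd_neg).2 hml) _
          rw [h2]; simp
        rw [hs, hnl]; simp
      · rw [Finsupp.single_eq_of_ne hj', hpneg _ (by omega)]; simp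
  refine ⟨key, _, key, ?_, ?_⟩
  · intro h
    have h1 : (Finsupp.single (-l) 1 : LaurentC) ∈ tailSpace (-l) :=
      Submodule.subset_span ⟨-l, le_rfl, rfl⟩
    rw [h, Submodule.mem_bot] at h1
    simp at h1
  · intro h
    have h1 : (Finsupp.single (-l - 1) 1 : LaurentC) ∈ tailSpace (-l) := by
      rw [h]; trivial
    have := (mem_tailSpace _ _).1 h1 (-l - 1) (by omega)
    simp at this
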